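/- A priori estimate under a growth condition: Let α, β ∈ (0,1) with α(1+β) > 1, λ ∈ (0,1] with β + λ ≤ 1, A ∈ C^α_t C^{β,λ}_V, x₀ ∈ V and κ ≥ 0. Let x ∈ C^α([0,T];V) satisfy x(0) = x₀ and, for every interval [s,t] ⊆ [0,T] and every [u,r] ⊆ [s,t], ‖x_r − x_u − A_{u,r}(x_u)‖_V ≤ κ ⟦A⟧_{α,β,R(s,t)} ⟦x⟧_{α;[s,t]}^β (r−u)^{α(1+β)}, where R(s,t) := sup_{v∈[s,t]} ‖x_v‖_V (as does, by the sewing lemma, every solution of the YDE x_t = x₀ + ∫_0^t A(ds,x_s), with κ depending only on α(1+β)). Then there is a constant C = C(α,β,T,κ) such that ‖x‖_α ≤ C exp(C ‖A‖_{α,β,λ}^{1+(1−α)/(αβ)}) (1 + ‖x₀‖_V). -/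

import Mathlib

/-- The `γ`-Hölder seminorm of a path on a subinterval `[a,b]`. -/
noncomputable def holderSemiBetween {V : Type*} [NormedAddCommGroup V]
    (γ a b : ℝ) (x : ℝ → V) : ℝ :=
  sSup {r : ℝ | ∃ s t : ℝ, a ≤ s ∧ s < t ∧ t ≤ b ∧ r = ‖x t - x s‖ / (t - s) ^ γ}

/-- The supremum of `‖x‖` over a subinterval `[a,b]`. -/
noncomputable def supNormBetween {V : Type*} [NormedAddCommGroup V]
    (a b : ℝ) (x : ℝ → V) : ℝ :=
  sSup {r : ℝ | ∃ t : ℝ, a ≤ t ∧ t ≤ b ∧ r = ‖x t‖}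

section HolderSeminorm

variable {V : Type*} [NormedAddCommGroup V]

theorem norm_sub_le_holderSemiBetween_mul {γ a b K : ℝ} {x : ℝ → V}
    (hK : ∀ s t, a ≤ s → s ≤ t → t ≤ b → ‖x t - x s‖ ≤ K * (t - s) ^ γ)
    {s t : ℝ} (has : a ≤ s) (hst : s ≤ t) (htb : t ≤ b) :
    ‖x t - x s‖ ≤ holderSemiBetween γ a b x * (t - s) ^ γ := by
  have hpos : ∀ {u v : ℝ}, u < v → 0 < (v - u) ^ γ := fun h ↦
    Real.rpow_pos_of_pos (sub_pos.2 h) γ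
  rcases hst.eq_or_lt with rfl | hlt
  · have : 0 ≤ holderSemiBetween γ a b x := by
      refine Real.sSup_nonneg ?_
      rintro r ⟨u, v, -, huv, -, rfl⟩
      have := hpos huv
      positivity
    simpa using mul_nonneg this (Real.rpow_nonneg le_rfl γ)
  · rw [← div_le_iff₀ (hpos hlt)]
    refine le_csSup ⟨K, ?_⟩ ⟨s, t, has, hlt, htb, rfl⟩
    rintro r ⟨u, v, hu, huv, hv, rfl⟩
    exact (div_le_iff₀ (hpos huv)).2 (hK u v hu huv.le hv)

theorem holderSemiBetween_nonneg (γ a b : ℝ) (x : ℝ → V) : 0 ≤ holderSemiBetween γ a b x := by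
  refine Real.sSup_nonneg ?_
  rintro r ⟨u, v, -, huv, -, rfl⟩
  have := Real.rpow_pos_of_pos (sub_pos.2 huv) γ
  positivity

theorem holderSemiBetween_le {γ a b K : ℝ} {x : ℝ → V} (hK0 : 0 ≤ K)
    (hK : ∀ s t, a ≤ s → s < t → t ≤ b → ‖x t - x s‖ ≤ K * (t - s) ^ γ) :
    holderSemiBetween γ a b x ≤ K := by
  refine Real.sSup_le ?_ hK0
  rintro r ⟨u, v, hu, huv, hv, rfl⟩
  exact (div_le_iff₀ (Real.rpow_pos_of_pos (sub_pos.2 huv) γ)).2 (hK u v hu huv hv)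

theorem supNormBetween_nonneg (a b : ℝ) (x : ℝ → V) : 0 ≤ supNormBetween a b x := by
  refine Real.sSup_nonneg ?_
  rintro r ⟨u, -, -, rfl⟩
  positivity

theorem norm_le_add_holderSemiBetween_mul {γ a b K : ℝ} {x : ℝ → V} (hγ : 0 ≤ γ)
    (hK : ∀ s t, a ≤ s → s ≤ t → t ≤ b → ‖x t - x s‖ ≤ K * (t - s) ^ γ)
    {t : ℝ} (hat : a ≤ t) (htb : t ≤ b) :
    ‖x t‖ ≤ ‖x a‖ + holderSemiBetween γ a b x * (b - a) ^ γ := by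
  have h1 := norm_sub_le_holderSemiBetween_mul hK le_rfl hat htb
  have h2 : (t - a) ^ γ ≤ (b - a) ^ γ :=
    Real.rpow_le_rpow (by linarith) (by linarith) hγ
  have h3 := mul_le_mul_of_nonneg_left h2 (holderSemiBetween_nonneg γ a b x)
  have h4 := norm_le_norm_add_norm_sub' (x t) (x a)
  linarith

/-- On an interval so short that `2 * (2 + κ) * M * (b - a) ^ α ≤ 1`, the Hölder seminorm is
controlled linearly by the size of the path at the left endpoint. -/
theorem holderSemiBetween_le_of_sewing_bound {α β lam κ M K L a b : ℝ}
    {A : ℝ → V → V} {x : ℝ → V}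
    (hα : 0 < α) (hβ : 0 < β) (hlam : 0 < lam) (hβlam : β + lam ≤ 1)
    (hκ : 0 ≤ κ) (hM : 0 ≤ M) (hab : a ≤ b)
    (hA0 : ∀ s t, a ≤ s → s ≤ t → t ≤ b → ‖A t 0 - A s 0‖ ≤ M * (t - s) ^ α)
    (hA : ∀ s t, a ≤ s → s ≤ t → t ≤ b → ∀ R, 1 ≤ R → ∀ z w : V, ‖z‖ ≤ R → ‖w‖ ≤ R →
      ‖A t z - A s z - (A t w - A s w)‖ ≤ M * R ^ lam * (t - s) ^ α * ‖z - w‖ ^ β)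
    (hK : ∀ s t, a ≤ s → s ≤ t → t ≤ b → ‖x t - x s‖ ≤ K * (t - s) ^ α)
    (hsew : ∀ u r, a ≤ u → u ≤ r → r ≤ b →
      ‖x r - x u - (A r (x u) - A u (x u))‖ ≤
        κ * M * (1 + supNormBetween a b x) ^ lam *
          holderSemiBetween α a b x ^ β * (r - u) ^ (α * (1 + β)))
    (hML : 2 * (2 + κ) * M ≤ L) (hL : L * (b - a) ^ α ≤ 1) :
    holderSemiBetween α a b x ≤ L * (1 + ‖x a‖) := by
  set H := holderSemiBetween α a b x with hH
  set S := supNormBetween a b x with hS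
  have hH0 : 0 ≤ H := holderSemiBetween_nonneg α a b x
  have hS0 : 0 ≤ S := supNormBetween_nonneg a b x
  set τ := (b - a) ^ α with hτ
  have hτ0 : 0 ≤ τ := Real.rpow_nonneg (by linarith) _
  set Y := 1 + ‖x a‖ + H * τ with hY
  have hHτ : 0 ≤ H * τ := mul_nonneg hH0 hτ0
  have hY1 : 1 ≤ Y := by have := norm_nonneg (x a); linarith
  have hY0 : 0 < Y := by linarith
  have hnorm : ∀ t, a ≤ t → t ≤ b → ‖x t‖ ≤ ‖x a‖ + H * τ := fun t h1 h2 ↦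
    norm_le_add_holderSemiBetween_mul hα.le hK h1 h2
  have hSY : 1 + S ≤ Y := by
    have : S ≤ ‖x a‖ + H * τ := by
      refine Real.sSup_le ?_ (by positivity)
      rintro r ⟨t, h1, h2, rfl⟩
      exact hnorm t h1 h2
    linarith
  have hYpow : Y ^ lam * Y ^ β ≤ Y := by
    rw [← Real.rpow_add hY0]
    calc Y ^ (lam + β) ≤ Y ^ (1 : ℝ) := Real.rpow_le_rpow_of_exponent_le hY1 (by linarith)
      _ = Y := Real.rpow_one Y
  have hself : H ≤ (2 + κ) * M * Y := by
    refine holderSemiBetween_le (by positivity) fun u r hu hur hr ↦ ?_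
    have hub : u ≤ b := by linarith
    set ρ := (r - u) ^ α with hρ
    have hρ0 : 0 ≤ ρ := Real.rpow_nonneg (by linarith) _
    have hρτ : ρ ≤ τ := Real.rpow_le_rpow (by linarith) (by linarith) hα.le
    have hxu : ‖x u‖ ≤ Y := by linarith [hnorm u hu hub]
    have e1 := hsew u r hu hur.le hr
    have e2 := hA u r hu hur.le hr Y hY1 (x u) 0 hxu (by simpa using hY0.le)
    have e3 := hA0 u r hu hur.le hr
    have e4 : (r - u) ^ (α * (1 + β)) = ρ * ρ ^ β := by
      rw [hρ, ← Real.rpow_mul (by linarith), ← Real.rpow_add (by linarith)]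
      ring_nf
    have b1 : κ * M * (1 + S) ^ lam * H ^ β * (r - u) ^ (α * (1 + β)) ≤ κ * M * Y * ρ := by
      have p1 : (1 + S) ^ lam ≤ Y ^ lam := Real.rpow_le_rpow (by linarith) hSY hlam.le
      have p2 : H ^ β * ρ ^ β ≤ Y ^ β := by
        rw [← Real.mul_rpow hH0 hρ0]
        refine Real.rpow_le_rpow (by positivity) ?_ hβ.le
        have := mul_le_mul_of_nonneg_left hρτ hH0
        have := norm_nonneg (x a)
        linarith
      have p3 : (1 + S) ^ lam * (H ^ β * ρ ^ β) ≤ Y :=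
        (mul_le_mul p1 p2 (by positivity) (by positivity)).trans hYpow
      calc _ = κ * M * ((1 + S) ^ lam * (H ^ β * ρ ^ β)) * ρ := by rw [e4]; ring
        _ ≤ κ * M * Y * ρ := by gcongr
    have b2 : M * Y ^ lam * ρ * ‖x u - 0‖ ^ β ≤ M * Y * ρ := by
      have p2 : ‖x u - 0‖ ^ β ≤ Y ^ β := by
        rw [sub_zero]
        exact Real.rpow_le_rpow (norm_nonneg _) hxu hβ.le
      calc _ ≤ M * Y ^ lam * ρ * Y ^ β := by gcongr
        _ = M * (Y ^ lam * Y ^ β) * ρ := by ring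
        _ ≤ M * Y * ρ := by gcongr
    have b3 : M * ρ ≤ M * Y * ρ := by
      have := mul_le_mul_of_nonneg_left hY1 (mul_nonneg hM hρ0)
      linarith
    have htri : ‖x r - x u‖ ≤ ‖x r - x u - (A r (x u) - A u (x u))‖ +
        ‖A r (x u) - A u (x u) - (A r 0 - A u 0)‖ + ‖A r 0 - A u 0‖ := by
      refine le_trans (le_of_eq ?_) norm_add₃_le
      congr 1
      abel
    linarith
  have h1 : (2 + κ) * M * Y ≤ L / 2 * Y := mul_le_mul_of_nonneg_right (by linarith) hY0.le
  have h2 := mul_le_mul_of_nonneg_left hL hH0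
  have h3 : L / 2 * Y = L * (1 + ‖x a‖) / 2 + H * (L * τ) / 2 := by rw [hY]; ring
  linarith

end HolderSeminorm

theorem le_two_pow_mul_of_le_two_mul {T δ : ℝ} {f : ℝ → ℝ} (hδ : 0 ≤ δ)
    (hf : ∀ s t, 0 ≤ s → s ≤ t → t ≤ T → t - s ≤ δ → f t ≤ 2 * f s) (n : ℕ) :
    ∀ t, 0 ≤ t → t ≤ T → t ≤ n * δ → f t ≤ 2 ^ n * f 0 := by
  induction n with
  | zero =>
    intro t ht _ htn
    obtain rfl : t = 0 := le_antisymm (by simpa using htn) ht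
    simp
  | succ n ih =>
    intro t ht htT htn
    push_cast at htn
    have hs : f (max 0 (t - δ)) ≤ 2 ^ n * f 0 := by
      refine ih _ (le_max_left _ _) (max_le (ht.trans htT) (by linarith)) (max_le ?_ ?_)
      · positivity
      · linarith
    have := hf (max 0 (t - δ)) t (le_max_left _ _) (max_le ht (by linarith)) htT
      (by linarith [le_max_right 0 (t - δ)])
    rw [pow_succ]
    linarith

theorem one_add_rpow_le_two_rpow_mul {m p q : ℝ} (hm : 0 ≤ m) (hq : 0 ≤ q) (hqp : q ≤ p) :
    (1 + m) ^ q ≤ 2 ^ q * (1 + m ^ p) := by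
  have hmp : 0 ≤ m ^ p := Real.rpow_nonneg hm p
  rcases le_total m 1 with h | h
  · calc (1 + m) ^ q ≤ 2 ^ q := Real.rpow_le_rpow (by linarith) (by linarith) hq
      _ ≤ 2 ^ q * (1 + m ^ p) := le_mul_of_one_le_right (by positivity) (by linarith)
  · calc (1 + m) ^ q ≤ (2 * m) ^ q := Real.rpow_le_rpow (by linarith) (by linarith) hq
      _ = 2 ^ q * m ^ q := Real.mul_rpow (by norm_num) hm
      _ ≤ 2 ^ q * (1 + m ^ p) := by
        have := Real.rpow_le_rpow_of_exponent_le h hqp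
        gcongr
        linarith

/-- Passage from the bound on short intervals to a global bound, with growth factor exponential
in `L ^ α⁻¹`. -/
theorem global_bounds_of_local_holder_bound {V : Type*} [NormedAddCommGroup V]
    {α T L : ℝ} {x : ℝ → V} (hα0 : 0 < α) (hα1 : α ≤ 1) (hT : 0 ≤ T) (hL : 1 ≤ L)
    (hloc : ∀ s t, 0 ≤ s → s ≤ t → t ≤ T → L * (t - s) ^ α ≤ 1 →
      ‖x t - x s‖ ≤ L * (1 + ‖x s‖) * (t - s) ^ α) :
    (∀ t, 0 ≤ t → t ≤ T →
      ‖x t‖ ≤ 2 * Real.exp ((T + 1) * L ^ α⁻¹ + 1) * (1 + ‖x 0‖)) ∧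
    (∀ s t, 0 ≤ s → s ≤ t → t ≤ T →
      ‖x t - x s‖ ≤ 2 * Real.exp ((T + 1) * L ^ α⁻¹ + 1) * (1 + ‖x 0‖) * (t - s) ^ α) := by
  have hL0 : 0 < L := by linarith
  set Q := L ^ α⁻¹ with hQ
  have hQ0 : 0 < Q := Real.rpow_pos_of_pos hL0 _
  have hQα : Q ^ α = L := by rw [hQ, ← Real.rpow_mul hL0.le, inv_mul_cancel₀ hα0.ne', Real.rpow_one]
  have hLQ : L ≤ Q := by
    calc L = L ^ (1 : ℝ) := (Real.rpow_one L).symm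
      _ ≤ Q := Real.rpow_le_rpow_of_exponent_le hL ((one_le_inv₀ hα0).2 hα1)
  have hsmall : ∀ d, 0 ≤ d → d ≤ Q⁻¹ → L * d ^ α ≤ 1 := by
    intro d hd hdQ
    rw [← hQα, ← Real.mul_rpow hQ0.le hd]
    refine Real.rpow_le_one (by positivity) ?_ hα0.le
    calc Q * d ≤ Q * Q⁻¹ := by gcongr
      _ = 1 := mul_inv_cancel₀ hQ0.ne'
  have hstep : ∀ s t, 0 ≤ s → s ≤ t → t ≤ T → t - s ≤ Q⁻¹ →
      1 + ‖x t‖ ≤ 2 * (1 + ‖x s‖) := by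
    intro s t hs hst ht hd
    have h1 := hsmall (t - s) (by linarith) hd
    have h2 := hloc s t hs hst ht h1
    have h3 := mul_le_mul_of_nonneg_left h1 (by positivity : 0 ≤ 1 + ‖x s‖)
    have h4 := norm_le_norm_add_norm_sub' (x t) (x s)
    linarith
  set N := ⌈T * Q⌉₊ with hN
  set E := Real.exp (T * Q + 1) with hE
  set B := E * (1 + ‖x 0‖) with hB
  have hsup : ∀ t, 0 ≤ t → t ≤ T → 1 + ‖x t‖ ≤ B := by
    intro t ht htT
    have htN : t ≤ N * Q⁻¹ := by
      rw [← div_eq_mul_inv, le_div_iff₀ hQ0]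
      exact (mul_le_mul_of_nonneg_right htT hQ0.le).trans (Nat.le_ceil _)
    refine (le_two_pow_mul_of_le_two_mul (f := fun t ↦ 1 + ‖x t‖) (by positivity) hstep
      N t ht htT htN).trans ?_
    refine mul_le_mul_of_nonneg_right ?_ (by positivity)
    have h2 : (2 : ℝ) ≤ Real.exp 1 := by linarith [Real.add_one_le_exp (1 : ℝ)]
    calc (2 : ℝ) ^ N ≤ Real.exp 1 ^ N := by gcongr
      _ = Real.exp N := by rw [← Real.exp_nat_mul, mul_one]
      _ ≤ E := Real.exp_le_exp.2 (Nat.ceil_lt_add_one (by positivity)).le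
  have hQE : Q ≤ Real.exp Q := by linarith [Real.add_one_le_exp Q]
  have hE' : Real.exp ((T + 1) * Q + 1) = Real.exp Q * E := by
    rw [hE, ← Real.exp_add]
    ring_nf
  have hB0 : 0 ≤ B := by positivity
  have hfin : 2 * L * B ≤ 2 * Real.exp ((T + 1) * Q + 1) * (1 + ‖x 0‖) := by
    rw [hE']
    calc 2 * L * B ≤ 2 * Real.exp Q * B := by gcongr; exact hLQ.trans hQE
      _ = _ := by rw [hB]; ring
  refine ⟨fun t ht htT ↦ ?_, fun s t hs hst ht ↦ ?_⟩
  · have h1 := hsup t ht htT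
    have h2 := mul_le_mul_of_nonneg_right hL hB0
    linarith
  · have hd0 : 0 ≤ (t - s) ^ α := Real.rpow_nonneg (by linarith) _
    refine le_trans ?_ (mul_le_mul_of_nonneg_right hfin hd0)
    have hBs := hsup s hs (hst.trans ht)
    rcases le_total (L * (t - s) ^ α) 1 with h | h
    · refine (hloc s t hs hst ht h).trans (mul_le_mul_of_nonneg_right ?_ hd0)
      have := mul_le_mul_of_nonneg_left hBs hL0.le
      have := mul_nonneg hL0.le hB0
      linarith
    · have hBt := hsup t (hs.trans hst) ht
      have h1 := norm_sub_le (x t) (x s)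
      have h2 := mul_le_mul_of_nonneg_right h hB0
      linarith

/-- **A priori estimate under a growth condition.**  Let `α(1+β) > 1`, `λ ∈ (0,1]` with
`β + λ ≤ 1` and `A ∈ C^α_t C^{β,λ}_V` (with `‖A‖_{α,β,λ} ≤ MA`).  Any `x ∈ C^α([0,T];V)` with
`x 0 = x₀` satisfying the localized sewing bound of a solution of the YDE satisfies
`‖x‖_α ≤ C exp(C ‖A‖_{α,β,λ}^{1+(1-α)/(αβ)}) (1 + ‖x₀‖)` with `C = C(α,β,T,κ)`. -/
theorem apriori_estimate_growth
    {V : Type*} [NormedAddCommGroup V] [NormedSpace ℝ V]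
    (α β lam : ℝ) (hα0 : 0 < α) (hα1 : α < 1) (hβ0 : 0 < β) (hβ1 : β < 1)
    (hαβ : 1 < α * (1 + β)) (hlam0 : 0 < lam) (hlam1 : lam ≤ 1) (hβlam : β + lam ≤ 1)
    (T : ℝ) (hT : 0 < T) (κ : ℝ) (hκ : 0 ≤ κ) :
    ∃ C : ℝ, 0 ≤ C ∧
      ∀ (A : ℝ → V → V) (MA : ℝ) (x₀ : V) (x : ℝ → V) (Kx : ℝ),
        0 ≤ MA →
        (∀ z : V, A 0 z = 0) →
        (∀ s t : ℝ, 0 ≤ s → s ≤ t → t ≤ T →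
          ‖A t 0 - A s 0‖ ≤ MA * (t - s) ^ α) →
        (∀ s t : ℝ, 0 ≤ s → s ≤ t → t ≤ T → ∀ R : ℝ, 1 ≤ R → ∀ z w : V,
          ‖z‖ ≤ R → ‖w‖ ≤ R →
          ‖A t z - A s z - (A t w - A s w)‖ ≤
            MA * R ^ lam * (t - s) ^ α * ‖z - w‖ ^ β) →
        x 0 = x₀ →
        (∀ s t : ℝ, 0 ≤ s → s ≤ t → t ≤ T → ‖x t - x s‖ ≤ Kx * (t - s) ^ α) →
        (∀ s t : ℝ, 0 ≤ s → s ≤ t → t ≤ T → ∀ u r : ℝ, s ≤ u → u ≤ r → r ≤ t →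
          ‖x r - x u - (A r (x u) - A u (x u))‖ ≤
            κ * MA * (1 + supNormBetween s t x) ^ lam *
              holderSemiBetween α s t x ^ β * (r - u) ^ (α * (1 + β))) →
        (∀ t : ℝ, 0 ≤ t → t ≤ T →
          ‖x t‖ ≤ C * Real.exp (C * MA ^ (1 + (1 - α) / (α * β))) * (1 + ‖x₀‖)) ∧
        (∀ s t : ℝ, 0 ≤ s → s ≤ t → t ≤ T →
          ‖x t - x s‖ ≤
            C * Real.exp (C * MA ^ (1 + (1 - α) / (α * β))) * (1 + ‖x₀‖) * (t - s) ^ α) := by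
  set p := 1 + (1 - α) / (α * β) with hp
  set D := (T + 1) * ((2 * (2 + κ)) ^ α⁻¹ * 2 ^ α⁻¹) with hD
  have hD0 : 0 ≤ D := by positivity
  have hqp : α⁻¹ ≤ p := by
    have h1 : α⁻¹ = 1 + (1 - α) / α := by field_simp; ring
    rw [h1, hp]
    have : α * β ≤ α := by nlinarith
    have : 0 ≤ 1 - α := by linarith
    gcongr
  refine ⟨2 * Real.exp (D + 1) + D, by positivity, ?_⟩
  intro A MA x₀ x Kx hMA _ hA0 hA hx0 hK hsew
  set L := 2 * (2 + κ) * (1 + MA) with hL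
  have hML : 2 * (2 + κ) * MA ≤ L := by rw [hL]; gcongr; linarith
  have hL1 : 1 ≤ L := by nlinarith [mul_nonneg hκ hMA]
  obtain ⟨hsup, hhol⟩ := global_bounds_of_local_holder_bound (x := x) hα0 hα1.le hT.le hL1 <| by
    intro s t hs hst ht hsmall
    have hK' : ∀ u v, s ≤ u → u ≤ v → v ≤ t → ‖x v - x u‖ ≤ Kx * (v - u) ^ α :=
      fun u v hu huv hv ↦ hK u v (hs.trans hu) huv (hv.trans ht)
    refine (norm_sub_le_holderSemiBetween_mul hK' le_rfl hst le_rfl).trans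
      (mul_le_mul_of_nonneg_right ?_ (Real.rpow_nonneg (by linarith) _))
    exact holderSemiBetween_le_of_sewing_bound hα0 hβ0 hlam0 hβlam hκ hMA hst
      (fun u v hu huv hv ↦ hA0 u v (hs.trans hu) huv (hv.trans ht))
      (fun u v hu huv hv ↦ hA u v (hs.trans hu) huv (hv.trans ht))
      hK' (hsew s t hs hst ht) hML hsmall
  have hMp : 0 ≤ MA ^ p := Real.rpow_nonneg hMA p
  have hLD : (T + 1) * L ^ α⁻¹ ≤ D + D * MA ^ p := by
    rw [hL, Real.mul_rpow (by positivity) (by positivity)]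
    have := one_add_rpow_le_two_rpow_mul hMA (inv_nonneg.2 hα0.le) hqp
    calc (T + 1) * ((2 * (2 + κ)) ^ α⁻¹ * (1 + MA) ^ α⁻¹)
        ≤ (T + 1) * ((2 * (2 + κ)) ^ α⁻¹ * (2 ^ α⁻¹ * (1 + MA ^ p))) := by gcongr
      _ = D + D * MA ^ p := by rw [hD]; ring
  set C := 2 * Real.exp (D + 1) + D with hC
  have hDC : D ≤ C := by have := Real.exp_pos (D + 1); linarith
  have hexp : 2 * Real.exp ((T + 1) * L ^ α⁻¹ + 1) ≤ C * Real.exp (C * MA ^ p) := by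
    calc 2 * Real.exp ((T + 1) * L ^ α⁻¹ + 1) ≤ 2 * Real.exp ((D + 1) + D * MA ^ p) := by
          gcongr 2 * Real.exp ?_
          linarith
      _ = 2 * Real.exp (D + 1) * Real.exp (D * MA ^ p) := by rw [Real.exp_add]; ring
      _ ≤ C * Real.exp (C * MA ^ p) := by
          gcongr
          linarith
  have hexp' := mul_le_mul_of_nonneg_right hexp (by positivity : 0 ≤ 1 + ‖x₀‖)
  rw [hx0] at hsup hhol
  exact ⟨fun t h1 h2 ↦ (hsup t h1 h2).trans hexp', fun s t h1 h2 h3 ↦ (hhol s t h1 h2 h3).trans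
    (mul_le_mul_of_nonneg_right hexp' (Real.rpow_nonneg (by linarith) _))⟩
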